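/- Let R be a (not necessarily commutative) ring and let d, δ, L, C ∈ R satisfy d·d = 0, δ·δ = 0, d·L = L·d, and L·δ − δ·L = d·C − C·d. Then the element Δ := d·δ + δ·d commutes with L, i.e. Δ·L = L·Δ. -/

import Mathlib

/-- If `d² = 0`, `δ² = 0`, `d` commutes with `L`, and `Lδ - δL = dC - Cd`,
then the Laplacian `Δ = dδ + δd` commutes with `L`. -/
theorem stmt_5 {R : Type*} [Ring R] (d δ L C : R)
    (hd : d * d = 0) (hδ : δ * δ = 0)
    (hdL : d * L = L * d)
    (hLδ : L * δ - δ * L = d * C - C * d) :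
    (d * δ + δ * d) * L = L * (d * δ + δ * d) := by
  have hcomm : L * (d * δ + δ * d) - (d * δ + δ * d) * L
      = d * (L * δ - δ * L) + (L * δ - δ * L) * d := by
    have h₁ : L * (d * δ) = d * (L * δ) := by rw [← mul_assoc, ← hdL, mul_assoc]
    have h₂ : δ * d * L = δ * L * d := by rw [mul_assoc, hdL, mul_assoc]
    rw [mul_add, add_mul, h₁, h₂]
    noncomm_ring
  have hzero : d * (d * C - C * d) + (d * C - C * d) * d = 0 := by
    rw [mul_sub, sub_mul, ← mul_assoc d d C, mul_assoc C d d, hd, mul_assoc d C d]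
    simp
  rw [hLδ, hzero] at hcomm
  exact (sub_eq_zero.mp hcomm).symm
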